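/- Let Δ, x, y be integers with Δ ≥ 2, 1 ≤ y ≤ Δ-1, 0 ≤ x, and x + y ≤ Δ. Let C be a multiset of Δ nonempty subsets of {M,P,O,X} that is universally closed and maximal for the collection of white configurations of Φ'_Δ(x,y). Then C extends to one of the following three multisets of subsets: (y-1 copies of {M,P,O,X}) + (one copy of {M,X}) + (Δ-y copies of {P,O,X}); (y copies of {M,P,O,X}) + (x copies of {P,O,X}) + (Δ-y-x copies of {O,X}); (y copies of {M,P,O,X}) + (one copy of {X}) + (Δ-y-1 copies of {P,O,X}). -/

import Mathlib

/-- The four-element alphabet {M, P, O, X}. -/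
inductive Label4 where
  | M | P | O | X
deriving DecidableEq

open Label4

/-- White configurations of Φ'_Δ(x,y). -/
def whitePhi' (Δ x y : ℕ) (w : Multiset Label4) : Prop :=
  (∃ s t u, w = s + (t ::ₘ u) ∧ Multiset.card s = y - 1 ∧ (t = M ∨ t = X) ∧
    Multiset.card u = Δ - y ∧ ∀ l ∈ u, l ∈ ({P, O, X} : Finset Label4)) ∨
  (∃ s u, w = s + u ∧ Multiset.card s = x ∧ (∀ l ∈ s, l ∈ ({P, O, X} : Finset Label4)) ∧
    Multiset.card u = Δ - x ∧ ∀ l ∈ u, l ∈ ({O, X} : Finset Label4))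

/-- `C` is universally closed for the collection `B`: every multiset obtained by
choosing one label from each subset in `C` belongs to `B`. -/
def universallyClosed {σ : Type*} (B : Multiset σ → Prop) (C : Multiset (Finset σ)) : Prop :=
  ∀ w : Multiset σ, Multiset.Rel (fun l F => l ∈ F) w C → B w

/-- `C` is maximal for `B`: enlarging one copy of a subset occurring in `C` by a new label
always destroys universal closedness. -/
def maximalFor {σ : Type*} [DecidableEq σ] (B : Multiset σ → Prop)
    (C : Multiset (Finset σ)) : Prop :=
  ∀ F ∈ C, ∀ l ∉ F, ¬ universallyClosed B (insert l F ::ₘ C.erase F)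

theorem Multiset.exists_add_of_le_countP {α : Type*} (p : α → Prop) [DecidablePred p]
    (C : Multiset α) {k : ℕ} (hk : k ≤ C.countP p) :
    ∃ A B, C = A + B ∧ Multiset.card A = k ∧ ∀ a ∈ A, p a := by
  rw [Multiset.countP_eq_card_filter] at hk
  obtain ⟨A, hA⟩ := Multiset.card_pos_iff_exists_mem.1 <|
    (Multiset.card_powersetCard k (C.filter p)).symm ▸ Nat.choose_pos hk
  obtain ⟨hA, hAk⟩ := Multiset.mem_powersetCard.1 hA
  obtain ⟨B, hB⟩ := Multiset.le_iff_exists_add.1 (hA.trans (Multiset.filter_le p C))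
  exact ⟨A, B, hB, hAk, fun a ha => Multiset.of_mem_filter (Multiset.mem_of_le hA ha)⟩

theorem Multiset.rel_map_self {α β : Type*} {r : β → α → Prop} (f : α → β) (C : Multiset α)
    (h : ∀ a ∈ C, r (f a) a) : Multiset.Rel r (C.map f) C :=
  Multiset.rel_map_left.2 (Multiset.rel_refl_of_refl_on h)

theorem Multiset.rel_subset_replicate {α : Type*} {C : Multiset (Finset α)} {S : Finset α} {n : ℕ}
    (hn : Multiset.card C = n) (h : ∀ F ∈ C, F ⊆ S) :
    Multiset.Rel (· ⊆ ·) C (Multiset.replicate n S) :=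
  Multiset.rel_replicate_right.2 ⟨hn, h⟩

theorem Label4.subset_full (F : Finset Label4) : F ⊆ {M, P, O, X} := by
  intro l _
  cases l <;> simp

theorem Label4.subset_POX {F : Finset Label4} (h : M ∉ F) : F ⊆ {P, O, X} := by
  intro l hl
  cases l <;> simp_all

theorem Label4.subset_OX {F : Finset Label4} (h : M ∉ F) (h' : P ∉ F) : F ⊆ {O, X} := by
  intro l hl
  cases l <;> simp_all

/-- If at most `n` members of `C` contain `M`, then `C` extends to `n` copies of the full
alphabet and `k` copies of `{P, O, X}`. -/
theorem Label4.rel_subset_full_add_POX {C : Multiset (Finset Label4)} {n k : ℕ}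
    (hC : Multiset.card C = n + k) (hM : C.countP (M ∈ ·) ≤ n) :
    Multiset.Rel (· ⊆ ·) C (Multiset.replicate n ({M, P, O, X} : Finset Label4) +
      Multiset.replicate k ({P, O, X} : Finset Label4)) := by
  have hcount := Multiset.card_eq_countP_add_countP (fun F : Finset Label4 => M ∈ F) C
  obtain ⟨A, B, rfl, hA, hAM⟩ :=
    C.exists_add_of_le_countP (fun F => M ∉ F) (k := k) (by lia)
  rw [Multiset.card_add] at hC
  rw [add_comm A B]
  exact (Multiset.rel_subset_replicate (by lia) fun F _ => subset_full F).add
    (Multiset.rel_subset_replicate hA fun F hF => subset_POX (hAM F hF))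

theorem whitePhi'.count_M_le {Δ x y : ℕ} (hy : 1 ≤ y) {w : Multiset Label4}
    (hw : whitePhi' Δ x y w) : w.count M ≤ y := by
  rcases hw with ⟨s, t, u, rfl, hs, -, -, hu⟩ | ⟨s, u, rfl, -, hs, -, hu⟩
  · have hu0 : u.count M = 0 := Multiset.count_eq_zero.2 fun h => by simpa using hu M h
    have hsM := s.count_le_card M
    rw [Multiset.count_add, Multiset.count_cons, hu0]
    split_ifs <;> lia
  · have hs0 : s.count M = 0 := Multiset.count_eq_zero.2 fun h => by simpa using hs M h
    have hu0 : u.count M = 0 := Multiset.count_eq_zero.2 fun h => by simpa using hu M h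
    rw [Multiset.count_add, hs0, hu0]
    lia

theorem whitePhi'.count_P_le {Δ x y : ℕ} {w : Multiset Label4}
    (hw : whitePhi' Δ x y w) (hM : M ∉ w) (hX : X ∉ w) : w.count P ≤ x := by
  rcases hw with ⟨s, t, u, rfl, -, rfl | rfl, -⟩ | ⟨s, u, rfl, hs, -, -, hu⟩
  · simp at hM
  · simp at hX
  · have hu0 : u.count P = 0 := Multiset.count_eq_zero.2 fun h => by simpa using hu P h
    rw [Multiset.count_add, hu0, ← hs]
    exact s.count_le_card P

theorem universallyClosed.countP_M_le {Δ x y : ℕ} (hy : 1 ≤ y) {C : Multiset (Finset Label4)}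
    (hne : ∀ F ∈ C, F.Nonempty) (hC : universallyClosed (whitePhi' Δ x y) C) :
    C.countP (M ∈ ·) ≤ y := by
  have hf : ∀ F : Finset Label4, ∃ l, F.Nonempty → l ∈ F ∧ (M ∈ F ↔ M = l) := by
    intro F
    by_cases h : M ∈ F
    · exact ⟨M, fun _ => by simp [h]⟩
    · by_cases hF : F.Nonempty
      · obtain ⟨l, hl⟩ := hF
        exact ⟨l, fun _ => ⟨hl, by grind⟩⟩
      · exact ⟨M, fun h => absurd h hF⟩
  choose f hf using hf
  have h := (hC _ (Multiset.rel_map_self f C fun F hF => (hf F (hne F hF)).1)).count_M_le hy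
  rw [Multiset.count_map, ← Multiset.countP_eq_card_filter] at h
  rwa [Multiset.countP_congr rfl fun F hF => propext (hf F (hne F hF)).2]

theorem universallyClosed.exists_subset_MX_or_countP_P_le {Δ x y : ℕ}
    {C : Multiset (Finset Label4)} (hC : universallyClosed (whitePhi' Δ x y) C) :
    (∃ F ∈ C, F ⊆ {M, X}) ∨ C.countP (P ∈ ·) ≤ x := by
  by_contra! ⟨hMX, hP⟩
  have hf : ∀ F : Finset Label4, ¬ F ⊆ {M, X} →
      (if P ∈ F then P else O) ∈ F := by
    intro F hF
    split_ifs with h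
    · exact h
    · contrapose! hF
      intro l hl
      cases l <;> simp_all
  have h := (hC _ (Multiset.rel_map_self (fun F => if P ∈ F then P else O) C
    fun F hF => hf F (hMX F hF))).count_P_le
      (by simp only [Multiset.mem_map]; grind) (by simp only [Multiset.mem_map]; grind)
  rw [Multiset.count_map, ← Multiset.countP_eq_card_filter,
    Multiset.countP_congr (p' := (P ∈ ·)) rfl (by intro F _; by_cases h : P ∈ F <;> simp [h])] at h
  lia

theorem stmt2 (Δ x y : ℕ) (hΔ : 2 ≤ Δ) (hy1 : 1 ≤ y) (hy2 : y ≤ Δ - 1)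
    (hxy : x + y ≤ Δ)
    (C : Multiset (Finset Label4)) (hcard : Multiset.card C = Δ)
    (hne : ∀ F ∈ C, F.Nonempty)
    (hclosed : universallyClosed (whitePhi' Δ x y) C)
    (hmax : maximalFor (whitePhi' Δ x y) C) :
    Multiset.Rel (· ⊆ ·) C
      (Multiset.replicate (y - 1) ({M, P, O, X} : Finset Label4) +
        (({M, X} : Finset Label4) ::ₘ
          Multiset.replicate (Δ - y) ({P, O, X} : Finset Label4))) ∨
    Multiset.Rel (· ⊆ ·) C
      (Multiset.replicate y ({M, P, O, X} : Finset Label4) +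
        Multiset.replicate x ({P, O, X} : Finset Label4) +
        Multiset.replicate (Δ - y - x) ({O, X} : Finset Label4)) ∨
    Multiset.Rel (· ⊆ ·) C
      (Multiset.replicate y ({M, P, O, X} : Finset Label4) +
        (({X} : Finset Label4) ::ₘ
          Multiset.replicate (Δ - y - 1) ({P, O, X} : Finset Label4))) := by
  have hM := hclosed.countP_M_le hy1 hne
  rcases hclosed.exists_subset_MX_or_countP_P_le with ⟨F, hF, hFMX⟩ | hP
  · obtain ⟨C, rfl⟩ := Multiset.exists_cons_of_mem hF
    rw [Multiset.card_cons] at hcard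
    rw [Multiset.countP_cons] at hM
    simp only [Multiset.add_cons]
    by_cases hMF : M ∈ F
    · rw [if_pos hMF] at hM
      exact .inl (.cons hFMX (rel_subset_full_add_POX (by lia) (by lia)))
    · rw [if_neg hMF] at hM
      refine .inr (.inr (.cons ?_ (rel_subset_full_add_POX (by lia) (by lia))))
      intro l hl
      have := hFMX hl
      cases l <;> simp_all
  · refine .inr (.inl ?_)
    have hcount : Multiset.card C ≤ C.countP (M ∈ ·) + C.countP (P ∈ ·) +
        C.countP (fun F => M ∉ F ∧ P ∉ F) := by
      clear * -
      induction C using Multiset.induction with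
      | empty => simp
      | cons F C ih =>
        simp only [Multiset.countP_cons, Multiset.card_cons]
        split_ifs <;> lia
    obtain ⟨A, B, rfl, hA, hAMP⟩ :=
      C.exists_add_of_le_countP (fun F => M ∉ F ∧ P ∉ F) (k := Δ - y - x) (by lia)
    rw [Multiset.card_add] at hcard
    rw [Multiset.countP_add] at hM
    rw [add_comm A B]
    exact (rel_subset_full_add_POX (by lia) (by lia)).add
      (Multiset.rel_subset_replicate hA fun F hF => subset_OX (hAMP F hF).1 (hAMP F hF).2)
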